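/- arXiv:2002.02700 — 3 statements merged into one kernel-verified Lean document; each statement's English description precedes it below -/
import Mathlib

section
/- Let ℓ be a line of the plane at infinity π_∞, let π_1,...,π_q be the q planes through ℓ other than π_∞, and choose for each i a point p_i on ℓ. Then the set S of all affine lines m such that, for some i, p_i ∈ m and m ⊆ π_i, is a line spread of AG(3,q). -/
theorem Submodule.finrank_sup_eq_add_one {K V : Type*} [DivisionRing K] [AddCommGroup V]
    [Module K V] [FiniteDimensional K V] {W P : Submodule K V} (hP : Module.finrank K P = 1)
    (h : ¬ P ≤ W) : Module.finrank K (W ⊔ P : Submodule K V) = Module.finrank K W + 1 := by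
  have hlt : W ⊓ P < P := lt_of_le_of_ne inf_le_right fun e => h (inf_eq_right.mp e)
  have := Submodule.finrank_lt_finrank_of_lt hlt
  have := Submodule.finrank_sup_add_finrank_inf_eq W P
  omega


open scoped Classical

namespace CL

variable (F : Type) [Field F] [Fintype F]

/-- Points of PG(3,q): 1-dimensional subspaces of F^4. -/
def PGPoint := {W : Submodule F (Fin 4 → F) // Module.finrank F W = 1}

/-- Lines of PG(3,q): 2-dimensional subspaces of F^4. -/
def PGLine := {W : Submodule F (Fin 4 → F) // Module.finrank F W = 2}

/-- Planes of PG(3,q): 3-dimensional subspaces of F^4. -/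
def PGPlane := {W : Submodule F (Fin 4 → F) // Module.finrank F W = 3}

/-- The plane at infinity: the hyperplane of vectors with last coordinate zero. -/
def infPlane : Submodule F (Fin 4 → F) := LinearMap.ker (LinearMap.proj (3 : Fin 4))

variable {F}

/-- A line of PG(3,q) is affine (a line of AG(3,q)) if it is not contained in π_∞. -/
def affLine (ℓ : PGLine F) : Prop := ¬ ℓ.1 ≤ infPlane F

/-- A point of PG(3,q) is affine if it does not lie in π_∞. -/
def affPoint (p : PGPoint F) : Prop := ¬ p.1 ≤ infPlane F

/-- A line spread of PG(3,q): every point lies on exactly one line of S. -/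
def IsPGSpread (S : Set (PGLine F)) : Prop :=
  ∀ p : PGPoint F, ∃! ℓ, ℓ ∈ S ∧ p.1 ≤ ℓ.1

/-- A line spread of AG(3,q): a set of affine lines such that every affine point
lies on exactly one line of S (i.e. pairwise disjoint affine lines partitioning AG(3,q)). -/
def IsAGSpread (S : Set (PGLine F)) : Prop :=
  (∀ ℓ ∈ S, affLine ℓ) ∧ ∀ p : PGPoint F, affPoint p → ∃! ℓ, ℓ ∈ S ∧ p.1 ≤ ℓ.1

/-- A Cameron-Liebler line class of parameter x in PG(3,q). -/
def IsCLPG (L : Set (PGLine F)) (x : ℕ) : Prop :=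
  ∀ S : Set (PGLine F), IsPGSpread S → (L ∩ S).ncard = x

/-- A Cameron-Liebler line class of parameter x in AG(3,q). -/
def IsCLAG (L : Set (PGLine F)) (x : ℕ) : Prop :=
  (∀ ℓ ∈ L, affLine ℓ) ∧
  ∀ S : Set (PGLine F), IsAGSpread S → (L ∩ S).ncard = x

end CL
/-- Let ℓ be a line of π_∞ and for each plane π ≠ π_∞ through ℓ choose a point f(π) on ℓ.
Then the set of affine lines m with f(π) ∈ m ⊆ π for some such plane π is a line spread
of AG(3,q). -/
theorem generalized_typeII_spread (F : Type) [Field F] [Fintype F]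
    (ℓ : CL.PGLine F) (hℓ : ℓ.1 ≤ CL.infPlane F)
    (f : CL.PGPlane F → CL.PGPoint F)
    (hf : ∀ π : CL.PGPlane F, ℓ.1 ≤ π.1 → π.1 ≠ CL.infPlane F → (f π).1 ≤ ℓ.1) :
    CL.IsAGSpread {m : CL.PGLine F | CL.affLine m ∧
      ∃ π : CL.PGPlane F, ℓ.1 ≤ π.1 ∧ π.1 ≠ CL.infPlane F ∧ (f π).1 ≤ m.1 ∧ m.1 ≤ π.1} := by
  refine ⟨fun m hm => hm.1, fun p hp => ?_⟩
  let π : CL.PGPlane F := ⟨ℓ.1 ⊔ p.1, by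
    rw [Submodule.finrank_sup_eq_add_one p.2 fun h => hp (h.trans hℓ), ℓ.2]⟩
  have hπ : π.1 ≠ CL.infPlane F := fun h => hp (le_sup_right.trans h.le)
  have hfπ : (f π).1 ≤ CL.infPlane F := (hf π le_sup_left hπ).trans hℓ
  have hm : Module.finrank F ((f π).1 ⊔ p.1 : Submodule F (Fin 4 → F)) = 2 := by
    rw [Submodule.finrank_sup_eq_add_one p.2 fun h => hp (h.trans hfπ), (f π).2]
  refine ⟨⟨(f π).1 ⊔ p.1, hm⟩, ⟨⟨fun h => hp (le_sup_right.trans h), π, le_sup_left, hπ,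
    le_sup_left, sup_le_sup_right (hf π le_sup_left hπ) _⟩, le_sup_right⟩, ?_⟩
  rintro m' ⟨⟨-, π', hℓπ', -, hfm', hm'π'⟩, hpm'⟩
  obtain rfl : π = π' := Subtype.ext <|
    Submodule.eq_of_le_of_finrank_eq (sup_le hℓπ' (hpm'.trans hm'π')) (π.2.trans π'.2.symm)
  exact Subtype.ext
    (Submodule.eq_of_le_of_finrank_eq (sup_le hfm' hpm') (hm.trans m'.2.symm)).symm
end

section
/- If L is a Cameron-Liebler line class of parameter x in AG(3,q), then L, viewed as a set of lines of PG(3,q), is a Cameron-Liebler line class of parameter x in PG(3,q). -/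
open scoped Classical

/-- The affine lines of a line spread of PG(3,q) form a line spread of AG(3,q). -/
theorem CL.IsPGSpread.isAGSpread {F : Type} [Field F] [Fintype F] {S : Set (CL.PGLine F)}
    (hS : CL.IsPGSpread S) : CL.IsAGSpread {ℓ ∈ S | CL.affLine ℓ} := by
  refine ⟨fun ℓ hℓ => hℓ.2, fun p hp => ?_⟩
  obtain ⟨ℓ, ⟨hℓS, hpℓ⟩, huniq⟩ := hS p
  exact ⟨ℓ, ⟨⟨hℓS, fun hle => hp (hpℓ.trans hle)⟩, hpℓ⟩, fun m hm => huniq m ⟨hm.1.1, hm.2⟩⟩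

/-- If L is a Cameron-Liebler line class of parameter x in AG(3,q), then L, viewed as a
set of lines of PG(3,q), is a Cameron-Liebler line class of parameter x in PG(3,q). -/
theorem affine_CL_is_projective_CL (F : Type) [Field F] [Fintype F]
    (L : Set (CL.PGLine F)) (x : ℕ) (h : CL.IsCLAG L x) :
    CL.IsCLPG L x := by
  intro S hS
  have hinter : L ∩ {ℓ ∈ S | CL.affLine ℓ} = L ∩ S :=
    Set.ext fun ℓ => ⟨fun hℓ => ⟨hℓ.1, hℓ.2.1⟩, fun hℓ => ⟨hℓ.1, hℓ.2, h.1 ℓ hℓ.1⟩⟩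
  rw [← hinter]
  exact h.2 _ hS.isAGSpread
end

section
/- Let L be a Cameron-Liebler line class of parameter x in PG(3,q). Then the set of affine lines of L is a Cameron-Liebler line class of parameter x in AG(3,q) if and only if L contains no line of the plane at infinity. -/
open scoped Classical

namespace CL

variable {F : Type} [Field F]

theorem finrank_line (ℓ : PGLine F) : Module.finrank F ℓ.1 = 2 := ℓ.2

theorem isPGSpread_iff (S : Set (PGLine F)) :
    IsPGSpread S ↔ ∀ v : Fin 4 → F, v ≠ 0 → ∃! ℓ, ℓ ∈ S ∧ v ∈ ℓ.1 := by
  constructor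
  · intro h v hv
    simpa [Submodule.span_singleton_le_iff_mem] using
      h ⟨Submodule.span F {v}, finrank_span_singleton hv⟩
  · rintro h ⟨W, hW⟩
    obtain ⟨v, hv, hspan⟩ := finrank_eq_one_iff'.mp hW
    have hle (ℓ : PGLine F) : W ≤ ℓ.1 ↔ (v : Fin 4 → F) ∈ ℓ.1 := by
      refine ⟨fun hℓ => hℓ v.2, fun hℓ w hw => ?_⟩
      obtain ⟨c, hc⟩ := hspan ⟨w, hw⟩
      have := ℓ.1.smul_mem c hℓ
      rwa [← Submodule.coe_smul, hc] at this
    simpa only [hle] using h v fun h0 => hv (Subtype.ext h0)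

theorem IsAGSpread.existsUnique {S : Set (PGLine F)} (h : IsAGSpread S) {v : Fin 4 → F}
    (hv : v ∉ infPlane F) : ∃! ℓ, ℓ ∈ S ∧ v ∈ ℓ.1 := by
  have hv0 : v ≠ 0 := fun h0 => hv (h0 ▸ Submodule.zero_mem _)
  simpa [Submodule.span_singleton_le_iff_mem] using
    h.2 ⟨Submodule.span F {v}, finrank_span_singleton hv0⟩
      (by simpa [affPoint, Submodule.span_singleton_le_iff_mem] using hv)

/-- Removing the lines at infinity from a projective spread leaves an affine spread. -/
theorem IsPGSpread.isAGSpread_s8 {S : Set (PGLine F)} (h : IsPGSpread S) :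
    IsAGSpread {ℓ ∈ S | affLine ℓ} := by
  refine ⟨fun ℓ hℓ => hℓ.2, fun p hp => ?_⟩
  obtain ⟨ℓ, ⟨h1, h2⟩, h3⟩ := h p
  exact ⟨ℓ, ⟨⟨h1, fun h4 => hp (h2.trans h4)⟩, h2⟩, fun m hm => h3 m ⟨hm.1.1, hm.2⟩⟩

theorem finrank_infPlane : Module.finrank F (infPlane F) = 3 := by
  have hsurj : Function.Surjective (LinearMap.proj (3 : Fin 4) : (Fin 4 → F) →ₗ[F] F) :=
    LinearMap.proj_surjective _
  have := LinearMap.finrank_range_add_finrank_ker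
    (LinearMap.proj (3 : Fin 4) : (Fin 4 → F) →ₗ[F] F)
  rw [LinearMap.range_eq_top.mpr hsurj, finrank_top, Module.finrank_self,
    Module.finrank_fin_fun] at this
  unfold infPlane
  omega

section Graph

variable {K : Type} [Field K] [Algebra F K]

/-- The line of `PG(3,q)` that is the graph of `φ` in the coordinates `e`. -/
def graphLine (e : (Fin 4 → F) ≃ₗ[F] K × K) (hK : Module.finrank F K = 2) (φ : K →ₗ[F] K) :
    PGLine F :=
  ⟨φ.graph.map (e.symm : K × K →ₗ[F] Fin 4 → F), by
    have hinj : Function.Injective (LinearMap.id.prod φ) := fun a b h => congrArg Prod.fst h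
    rw [LinearEquiv.finrank_map_eq, LinearMap.graph_eq_range_prod,
      LinearMap.finrank_range_of_inj hinj, hK]⟩

theorem mem_graphLine (e : (Fin 4 → F) ≃ₗ[F] K × K) (hK : Module.finrank F K = 2)
    (φ : K →ₗ[F] K) (v : Fin 4 → F) : v ∈ (graphLine e hK φ).1 ↔ (e v).2 = φ (e v).1 := by
  simp [graphLine, Submodule.mem_map_equiv]

theorem graphLine_injective (e : (Fin 4 → F) ≃ₗ[F] K × K) (hK : Module.finrank F K = 2) :
    Function.Injective (graphLine e hK) := by
  intro φ ψ h
  ext a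
  have := (mem_graphLine e hK φ (e.symm (a, φ a))).mpr (by simp)
  rw [h, mem_graphLine] at this
  simpa using this

variable {e : (Fin 4 → F) ≃ₗ[F] K × K} (hK : Module.finrank F K = 2) {ℓ : PGLine F}

theorem graphLine_inf_eq_bot (hℓ : ∀ v, v ∈ ℓ.1 ↔ (e v).1 = 0) (φ : K →ₗ[F] K) :
    (graphLine e hK φ).1 ⊓ ℓ.1 = ⊥ := by
  rw [eq_bot_iff]
  rintro v ⟨h1, h2⟩
  have h1 := (mem_graphLine e hK φ v).mp h1
  have h2 := (hℓ v).mp h2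
  rw [h2, map_zero] at h1
  exact (LinearEquiv.map_eq_zero_iff e).mp (Prod.ext h2 h1)

theorem graphLine_ne (hℓ : ∀ v, v ∈ ℓ.1 ↔ (e v).1 = 0) (φ : K →ₗ[F] K) :
    graphLine e hK φ ≠ ℓ := by
  intro h
  have h1 := graphLine_inf_eq_bot hK hℓ φ
  rw [h, inf_idem] at h1
  have := ℓ.2
  rw [h1, finrank_bot] at this
  omega

theorem exists_graphLine_eq (hℓ : ∀ v, v ∈ ℓ.1 ↔ (e v).1 = 0) {m : PGLine F}
    (hm : m.1 ⊓ ℓ.1 = ⊥) : ∃ φ, graphLine e hK φ = m := by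
  let f : m.1 →ₗ[F] K := LinearMap.fst F K K ∘ₗ e.toLinearMap ∘ₗ m.1.subtype
  have hinj : Function.Injective f := by
    rw [← LinearMap.ker_eq_bot, eq_bot_iff]
    intro v hv
    have : (v : Fin 4 → F) ∈ m.1 ⊓ ℓ.1 := ⟨v.2, (hℓ _).mpr hv⟩
    rw [hm] at this
    exact Subtype.ext this
  have : FiniteDimensional F K := Module.finite_of_finrank_eq_succ hK
  let g := LinearEquiv.ofInjectiveOfFinrankEq f hinj (by rw [hK]; exact m.2)
  refine ⟨LinearMap.snd F K K ∘ₗ e.toLinearMap ∘ₗ m.1.subtype ∘ₗ g.symm.toLinearMap, ?_⟩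
  refine Subtype.ext (Submodule.eq_of_le_of_finrank_eq ?_ ?_).symm
  · intro v hv
    rw [mem_graphLine]
    have : g.symm (e v).1 = ⟨v, hv⟩ := by
      rw [LinearEquiv.symm_apply_eq]; rfl
    simp [this]
  · rw [m.2, (graphLine _ _ _).2]

theorem isPGSpread_graphLine (hℓ : ∀ v, v ∈ ℓ.1 ↔ (e v).1 = 0) (φ : K →ₗ[F] K) :
    IsPGSpread (insert ℓ (Set.range fun k : K => graphLine e hK (φ + LinearMap.mulLeft F k))) := by
  rw [isPGSpread_iff]
  intro v hv
  by_cases h0 : (e v).1 = 0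
  · refine ⟨ℓ, ⟨Set.mem_insert _ _, (hℓ v).mpr h0⟩, ?_⟩
    rintro m ⟨rfl | ⟨k, rfl⟩, hm⟩
    · rfl
    · have := graphLine_inf_eq_bot hK hℓ (φ + LinearMap.mulLeft F k)
      exact absurd ((Submodule.mem_bot F).mp (this ▸ ⟨hm, (hℓ v).mpr h0⟩)) hv
  · refine ⟨graphLine e hK (φ + LinearMap.mulLeft F (((e v).2 - φ (e v).1) / (e v).1)),
      ⟨Set.mem_insert_of_mem _ ⟨_, rfl⟩, ?_⟩, ?_⟩
    · rw [mem_graphLine]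
      simp [div_mul_cancel₀ _ h0]
    · rintro m ⟨rfl | ⟨k, rfl⟩, hm⟩
      · exact absurd ((hℓ v).mp hm) h0
      · rw [mem_graphLine] at hm
        have : k = ((e v).2 - φ (e v).1) / (e v).1 := by
          rw [eq_div_iff h0, hm]
          simp
        simp [← this]

end Graph

variable [Fintype F]

noncomputable instance : Fintype (PGLine F) :=
  have : Finite (PGLine F) := Subtype.finite
  Fintype.ofFinite _

/-- Coordinates over a quadratic extension in which a given line is the second axis. -/
theorem exists_coordinates (ℓ : PGLine F) :
    ∃ (K : Type) (_ : Field K) (_ : Algebra F K) (_ : Fintype K)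
      (e : (Fin 4 → F) ≃ₗ[F] K × K), Module.finrank F K = 2 ∧ ∀ v, v ∈ ℓ.1 ↔ (e v).1 = 0 := by
  obtain ⟨p, hp⟩ := CharP.exists F
  have : Fact p.Prime := ⟨CharP.char_is_prime F p⟩
  have hK := FiniteField.finrank_extension F p 2
  obtain ⟨C, hC⟩ := Submodule.exists_isCompl ℓ.1
  have hsum := Submodule.finrank_add_eq_of_isCompl hC
  rw [ℓ.2, Module.finrank_fin_fun] at hsum
  let e₁ : C ≃ₗ[F] FiniteField.Extension F p 2 := LinearEquiv.ofFinrankEq _ _ (by omega)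
  let e₂ : ℓ.1 ≃ₗ[F] FiniteField.Extension F p 2 :=
    LinearEquiv.ofFinrankEq _ _ (by rw [ℓ.2, hK])
  refine ⟨FiniteField.Extension F p 2, inferInstance, inferInstance, Fintype.ofFinite _,
    (Submodule.prodEquivOfIsCompl C ℓ.1 hC.symm).symm.trans (e₁.prodCongr e₂), hK, fun v => ?_⟩
  rw [← Submodule.prodEquivOfIsCompl_symm_apply_fst_eq_zero C ℓ.1 hC.symm]
  simp

theorem exists_isPGSpread_mem (ℓ : PGLine F) : ∃ S, IsPGSpread S ∧ ℓ ∈ S := by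
  obtain ⟨K, _, _, _, e, hK, hℓ⟩ := exists_coordinates ℓ
  exact ⟨_, isPGSpread_graphLine hK hℓ 0, Set.mem_insert _ _⟩

/-- The characteristic function of a set of lines. -/
noncomputable def chi (L : Set (PGLine F)) (m : PGLine F) : ℚ := if m ∈ L then 1 else 0

theorem ncard_inter_eq_sum (L S : Set (PGLine F)) :
    ((L ∩ S).ncard : ℚ) = ∑ m with m ∈ S, chi L m := by
  simp only [chi, Finset.sum_boole, Finset.filter_filter]
  rw [Set.ncard_eq_toFinset_card']
  congr 2
  ext m
  simp [and_comm]

/-- A Cameron-Liebler class of parameter `x` has `q²(x - 1)` lines skew to each of its lines, and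
`q²x` lines skew to each line outside it. -/
theorem IsCLPG.sum_skew {L : Set (PGLine F)} {x : ℕ} (h : IsCLPG L x) (ℓ : PGLine F) :
    ∑ m with m.1 ⊓ ℓ.1 = ⊥, chi L m = (Fintype.card F : ℚ) ^ 2 * (x - chi L ℓ) := by
  obtain ⟨K, _, _, _, e, hK, hℓ⟩ := exists_coordinates ℓ
  have : FiniteDimensional F K := Module.finite_of_finrank_eq_succ hK
  have : Finite (K →ₗ[F] K) := Module.finite_of_finite F
  let _ : Fintype (K →ₗ[F] K) := Fintype.ofFinite _
  have hcard : Fintype.card K = Fintype.card F ^ 2 := by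
    rw [Module.card_eq_pow_finrank (K := F), hK]
  have hcard' : Fintype.card (K →ₗ[F] K) = Fintype.card F ^ 4 := by
    rw [Module.card_eq_pow_finrank (K := F), Module.finrank_linearMap, hK]
  have hskew : ∑ m with m.1 ⊓ ℓ.1 = ⊥, chi L m = ∑ φ, chi L (graphLine e hK φ) := by
    symm
    refine Finset.sum_bij (fun φ _ => graphLine e hK φ) ?_ ?_ ?_ ?_
    · exact fun φ _ => by simpa using graphLine_inf_eq_bot hK hℓ φ
    · exact fun φ _ ψ _ hφψ => graphLine_injective e hK hφψ
    · intro m hm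
      obtain ⟨φ, hφ⟩ := exists_graphLine_eq hK hℓ (Finset.mem_filter.mp hm).2
      exact ⟨φ, Finset.mem_univ _, hφ⟩
    · exact fun _ _ => rfl
  have hspread (φ : K →ₗ[F] K) :
      (x : ℚ) = chi L ℓ + ∑ k : K, chi L (graphLine e hK (φ + LinearMap.mulLeft F k)) := by
    have hinj : Function.Injective
        fun k : K => graphLine e hK (φ + LinearMap.mulLeft F k) := by
      intro a b hab
      have := congrArg (fun f : K →ₗ[F] K => f 1) (graphLine_injective e hK hab)
      simpa using this
    rw [← h _ (isPGSpread_graphLine hK hℓ φ), ncard_inter_eq_sum,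
      ← Finset.sum_image (f := chi L) (s := Finset.univ) hinj.injOn, ← Finset.sum_insert]
    · refine Finset.sum_congr ?_ fun _ _ => rfl
      ext m
      simp
    · simp [graphLine_ne hK hℓ]
  have htotal := Finset.sum_congr (rfl : (Finset.univ : Finset (K →ₗ[F] K)) = Finset.univ)
    fun φ _ => hspread φ
  rw [Finset.sum_add_distrib, Finset.sum_comm] at htotal
  have hshift (k : K) : ∑ φ, chi L (graphLine e hK (φ + LinearMap.mulLeft F k)) =
      ∑ φ, chi L (graphLine e hK φ) :=
    Equiv.sum_comp (Equiv.addRight (LinearMap.mulLeft F k)) fun φ => chi L (graphLine e hK φ)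
  simp only [hshift, Finset.sum_const, Finset.card_univ, hcard, hcard', nsmul_eq_mul,
    Nat.cast_pow] at htotal
  rw [hskew]
  have hq : (Fintype.card F : ℚ) ^ 2 ≠ 0 := by simp
  apply mul_left_cancel₀ hq
  linarith

theorem sum_mem_eq_card_inf (L : Set (PGLine F)) (ℓ : PGLine F) :
    ∑ v with v ∈ ℓ.1, ∑ m with v ∈ m.1, chi L m =
      ∑ m, (Fintype.card F : ℚ) ^ Module.finrank F ↥(m.1 ⊓ ℓ.1) * chi L m := by
  rw [Finset.sum_comm' (t' := Finset.univ) (s' := fun m => {v | v ∈ m.1 ⊓ ℓ.1})]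
  · refine Finset.sum_congr rfl fun m _ => ?_
    rw [Finset.sum_const, nsmul_eq_mul]
    congr 1
    rw [← Nat.cast_pow, ← Module.card_eq_pow_finrank, Fintype.card_subtype]
  · intro v m
    simp [and_comm]

theorem card_pow_finrank_inf (m ℓ : PGLine F) :
    (Fintype.card F : ℚ) ^ Module.finrank F ↥(m.1 ⊓ ℓ.1) =
      Fintype.card F + (1 - Fintype.card F) * (if m.1 ⊓ ℓ.1 = ⊥ then 1 else 0) +
        (Fintype.card F ^ 2 - Fintype.card F) * (if m = ℓ then 1 else 0) := by
  by_cases h0 : m = ℓ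
  · subst h0
    have : m.1 ≠ ⊥ := by
      intro h
      have := m.2
      rw [h, finrank_bot] at this
      omega
    rw [inf_idem, finrank_line]
    simp [this]
  by_cases h1 : m.1 ⊓ ℓ.1 = ⊥
  · rw [h1, finrank_bot]
    simp [h0]
  have h2 : Module.finrank F ↥(m.1 ⊓ ℓ.1) ≠ 0 := by
    rwa [Ne, Submodule.finrank_eq_zero]
  have h3 : Module.finrank F ↥(m.1 ⊓ ℓ.1) < 2 := by
    refine (Submodule.finrank_lt_finrank_of_lt ?_).trans_eq (finrank_line m)
    refine lt_of_le_of_ne inf_le_left fun h => h0 ?_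
    exact Subtype.ext (Submodule.eq_of_le_of_finrank_eq (inf_eq_left.mp h) (m.2.trans ℓ.2.symm))
  have h4 : Module.finrank F ↥(m.1 ⊓ ℓ.1) = 1 := by omega
  simp [h0, h1, h4]

theorem card_mem (ℓ : PGLine F) :
    (Finset.card {v | v ∈ ℓ.1} : ℚ) = (Fintype.card F : ℚ) ^ 2 := by
  rw [← Fintype.card_subtype, ← Nat.cast_pow]
  have := Module.card_eq_pow_finrank (K := F) (V := ℓ.1)
  rw [ℓ.2] at this
  exact_mod_cast this

/-- The characteristic vector of a Cameron-Liebler class lies in the row space of the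
point-line incidence matrix, with point weights given as functions on vectors. -/
theorem IsCLPG.exists_weight {L : Set (PGLine F)} {x : ℕ} (h : IsCLPG L x) :
    ∃ b : (Fin 4 → F) → ℚ, b 0 = 0 ∧ (∀ (c : F) v, c ≠ 0 → b (c • v) = b v) ∧
      ∀ ℓ : PGLine F, ∑ v with v ∈ ℓ.1, b v = chi L ℓ := by
  set q : ℚ := (Fintype.card F : ℚ) with hq
  have hq1 : 1 < q := Nat.one_lt_cast.mpr Fintype.one_lt_card
  set n : (Fin 4 → F) → ℚ := fun v => ∑ m with v ∈ m.1, chi L m with hn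
  have hn_sum (ℓ : PGLine F) : ∑ v with v ∈ ℓ.1, n v =
      (q ^ 3 - q) * chi L ℓ + (q * ∑ m, chi L m + (1 - q) * q ^ 2 * x) := by
    rw [hn, sum_mem_eq_card_inf]
    have h2 : ∑ m, (if m.1 ⊓ ℓ.1 = ⊥ then 1 else 0) * chi L m = q ^ 2 * (x - chi L ℓ) := by
      rw [← h.sum_skew ℓ, Finset.sum_filter]
      simp
    have h3 : ∑ m, (if m = ℓ then 1 else 0) * chi L m = chi L ℓ := by simp
    rw [Finset.sum_congr rfl fun m _ => congrArg (· * chi L m) (card_pow_finrank_inf m ℓ)]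
    simp only [add_mul, Finset.sum_add_distrib, mul_assoc, ← Finset.mul_sum, ← hq]
    rw [h2, h3]
    ring
  set C : ℚ := q * ∑ m, chi L m + (1 - q) * q ^ 2 * x
  set D : ℚ := (C - n 0) / (q ^ 2 - 1) with hD
  have hq2 : q ^ 2 - 1 ≠ 0 := by nlinarith
  have hq3 : q ^ 3 - q ≠ 0 := by
    have : q ^ 3 - q = q * (q ^ 2 - 1) := by ring
    rw [this]
    exact mul_ne_zero (by linarith) hq2
  refine ⟨fun v => if v = 0 then 0 else (n v - D) / (q ^ 3 - q), by simp, ?_, ?_⟩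
  · intro c v hc
    have : n (c • v) = n v := by
      simp only [hn, Submodule.smul_mem_iff _ hc]
    simp [this, hc]
  · intro ℓ
    have hsplit (v : Fin 4 → F) : (if v = 0 then 0 else (n v - D) / (q ^ 3 - q)) =
        (n v - D - (if v = 0 then n 0 - D else 0)) / (q ^ 3 - q) := by
      split_ifs with hv <;> simp [hv]
    simp only [hsplit]
    rw [← Finset.sum_div, Finset.sum_sub_distrib, Finset.sum_sub_distrib, hn_sum,
      Finset.sum_const, nsmul_eq_mul, card_mem, Finset.sum_ite_eq', div_eq_iff hq3]
    rw [if_pos (by simp)]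
    have : D * (q ^ 2 - 1) = C - n 0 := div_mul_cancel₀ _ hq2
    linear_combination -this

theorem sum_smul_eq {b : (Fin 4 → F) → ℚ} (hb0 : b 0 = 0)
    (hb : ∀ (c : F) v, c ≠ 0 → b (c • v) = b v) (v : Fin 4 → F) :
    ∑ s : F, b (s • v) = (Fintype.card F - 1) * b v := by
  have hterm (s : F) : b (s • v) = b v - if s = 0 then b v else 0 := by
    split_ifs with hs
    · simp [hs, hb0]
    · simp [hb s v hs]
  simp [hterm, sub_mul]

theorem sum_plane_lines {b : (Fin 4 → F) → ℚ} (hb0 : b 0 = 0)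
    (hb : ∀ (c : F) v, c ≠ 0 → b (c • v) = b v) {H : Submodule F (Fin 4 → F)}
    (hline : ∀ ℓ : PGLine F, ℓ.1 ≤ H → ∑ v with v ∈ ℓ.1, b v = 0) {v : H} (hv0 : v ≠ 0) (w : H) :
    ∑ t : F, ∑ s : F, b (s • v + t • w : H) =
      if w ∈ Submodule.span F {v} then
        (Fintype.card F : ℚ) * ((Fintype.card F - 1) * b v) else 0 := by
  split_ifs with hw
  · obtain ⟨c, rfl⟩ := Submodule.mem_span_singleton.mp hw
    have hinner (t : F) : ∑ s : F, b (s • v + t • c • v : H) = (Fintype.card F - 1) * b v := by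
      rw [← sum_smul_eq hb0 hb,
        ← Equiv.sum_comp (Equiv.addRight (t * c)) fun s => b (s • (v : Fin 4 → F))]
      simp [add_smul, mul_smul]
    rw [Finset.sum_congr rfl fun t _ => hinner t]
    simp
  · have hind : LinearIndependent F ![(v : Fin 4 → F), w] := by
      refine LinearIndependent.pair_iff.mpr fun s t hst => ?_
      have hst' : s • v + t • w = 0 := Subtype.ext hst
      have ht : t = 0 := by
        by_contra ht
        refine hw (Submodule.mem_span_singleton.mpr ⟨-(t⁻¹ * s), ?_⟩)
        rw [neg_smul, neg_eq_iff_add_eq_zero, ← smul_zero t⁻¹, ← hst', smul_add, smul_smul,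
          smul_smul, inv_mul_cancel₀ ht, one_smul]
      subst ht
      simpa [hv0] using hst'
    let ℓ : PGLine F := ⟨Submodule.span F {(v : Fin 4 → F), (w : Fin 4 → F)}, by
      have := finrank_span_eq_card hind
      rwa [Matrix.range_cons_cons_empty, Fintype.card_fin] at this⟩
    rw [← hline ℓ (Submodule.span_le.mpr (by simp [Set.insert_subset_iff])),
      ← Fintype.sum_prod_type']
    refine Finset.sum_bij (fun p _ => p.2 • (v : Fin 4 → F) + p.1 • (w : Fin 4 → F)) ?_ ?_ ?_ ?_
    · intro p _
      simpa [ℓ] using Submodule.mem_span_pair.mpr ⟨p.2, p.1, rfl⟩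
    · intro p _ p' _ hpp
      obtain ⟨h2, h1⟩ := hind.eq_of_pair hpp
      exact Prod.ext h1 h2
    · intro u hu
      obtain ⟨s, t, rfl⟩ := Submodule.mem_span_pair.mp (Finset.mem_filter.mp hu).2
      exact ⟨(t, s), Finset.mem_univ _, rfl⟩
    · intro p _
      rfl

theorem sum_plane_translate {b : (Fin 4 → F) → ℚ} (hb0 : b 0 = 0)
    (hb : ∀ (c : F) v, c ≠ 0 → b (c • v) = b v) {H : Submodule F (Fin 4 → F)} (v : H) (t : F) :
    ∑ s : F, ∑ w : H, b (s • v + t • w : H) =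
      (Fintype.card F : ℚ) * ∑ w : H, b w + (if t = 0 then
        (Fintype.card H : ℚ) * ((Fintype.card F - 1) * b v) -
          (Fintype.card F : ℚ) * ∑ w : H, b w else 0) := by
  split_ifs with ht
  · subst ht
    have := sum_smul_eq hb0 hb (v : Fin 4 → F)
    simp [← Finset.mul_sum, this]
  · have hinner (s : F) : ∑ w : H, b (s • v + t • w : H) = ∑ w : H, b w :=
      ((LinearEquiv.smulOfNeZero F H t ht).toEquiv.trans (Equiv.addLeft (s • v))).sum_comp
        fun w : H => b w
    simp only [hinner]
    simp

/-- A homogeneous weight that sums to zero over all lines of a plane vanishes on the plane. -/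
theorem weight_eq_zero {b : (Fin 4 → F) → ℚ} (hb0 : b 0 = 0)
    (hb : ∀ (c : F) v, c ≠ 0 → b (c • v) = b v) {H : Submodule F (Fin 4 → F)}
    (hH : Module.finrank F H = 3)
    (hline : ∀ ℓ : PGLine F, ℓ.1 ≤ H → ∑ v with v ∈ ℓ.1, b v = 0) {v : Fin 4 → F} (hv : v ∈ H) :
    b v = 0 := by
  have hq1 : (1 : ℚ) < Fintype.card F := by exact_mod_cast Fintype.one_lt_card
  have hcardH : (Fintype.card H : ℚ) = (Fintype.card F : ℚ) ^ 3 := by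
    rw [Module.card_eq_pow_finrank (K := F), hH, Nat.cast_pow]
  generalize hT : ∑ w : H, b w = T
  have hconst (u : H) (hu : u ≠ 0) :
      (Fintype.card F - (Fintype.card F : ℚ) ^ 2) * b u = T := by
    have hcard : (Finset.card {w : H | w ∈ Submodule.span F {u}} : ℚ) = Fintype.card F := by
      rw [← Fintype.card_subtype]
      have := Module.card_eq_pow_finrank (K := F) (V := Submodule.span F {u})
      rw [finrank_span_singleton hu, pow_one] at this
      exact_mod_cast this
    have h1 := Finset.sum_congr (rfl : (Finset.univ : Finset H) = Finset.univ)
      fun w _ => sum_plane_lines hb0 hb hline hu w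
    rw [Finset.sum_comm] at h1
    have h2 (t : F) : ∑ w : H, ∑ s : F, b (s • u + t • w : H) = _ :=
      Finset.sum_comm.trans (sum_plane_translate hb0 hb u t)
    rw [Finset.sum_congr rfl fun t _ => h2 t, Finset.sum_add_distrib, Finset.sum_ite_eq',
      if_pos (Finset.mem_univ _), ← Finset.sum_filter, Finset.sum_const, Finset.sum_const,
      nsmul_eq_mul, nsmul_eq_mul, hcard, Finset.card_univ, hcardH, hT] at h1
    have h3 : (Fintype.card F : ℚ) * (Fintype.card F - 1) ≠ 0 :=
      mul_ne_zero (by linarith) (by linarith)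
    apply mul_left_cancel₀ h3
    linear_combination -h1
  rcases eq_or_ne v 0 with rfl | hv0
  · exact hb0
  have hsum : T = (Fintype.card H - 1) * b v := by
    have hne : (Fintype.card F - (Fintype.card F : ℚ) ^ 2) ≠ 0 := by nlinarith
    have hterm (w : H) : b w = b v - if w = 0 then b v else 0 := by
      split_ifs with hw
      · simp [hw, hb0]
      · rw [sub_zero]
        exact mul_left_cancel₀ hne
          ((hconst w hw).trans (hconst ⟨v, hv⟩ fun h => hv0 (congrArg Subtype.val h)).symm)
    rw [← hT, Finset.sum_congr rfl fun w _ => hterm w]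
    simp [sub_mul]
  have hv' := hconst ⟨v, hv⟩ fun h => hv0 (congrArg Subtype.val h)
  rw [hsum, hcardH] at hv'
  have h0 :
      ((Fintype.card F : ℚ) ^ 3 - 1 - (Fintype.card F - (Fintype.card F : ℚ) ^ 2)) * b v = 0 := by
    linear_combination -hv'
  refine (mul_eq_zero.mp h0).resolve_left ?_
  nlinarith [sq_nonneg ((Fintype.card F : ℚ) - 1), pow_pos (zero_lt_one.trans hq1) 3]

theorem sum_spread {b : (Fin 4 → F) → ℚ} {L : Set (PGLine F)}
    (hb : ∀ ℓ : PGLine F, ∑ v with v ∈ ℓ.1, b v = chi L ℓ) {S : Set (PGLine F)}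
    (hS : ∀ v, b v ≠ 0 → ∃! ℓ, ℓ ∈ S ∧ v ∈ ℓ.1) :
    ((L ∩ S).ncard : ℚ) = ∑ v, b v := by
  rw [ncard_inter_eq_sum]
  simp_rw [← hb]
  rw [Finset.sum_comm' (t' := Finset.univ) (s' := fun v => {m | m ∈ S ∧ v ∈ m.1})]
  · refine Finset.sum_congr rfl fun v _ => ?_
    by_cases hv : b v = 0
    · simp [hv]
    obtain ⟨ℓ, h1, h2⟩ := hS v hv
    have : ({m | m ∈ S ∧ v ∈ m.1} : Finset (PGLine F)) = {ℓ} := by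
      ext m
      simp only [Finset.mem_filter, Finset.mem_univ, true_and, Finset.mem_singleton]
      exact ⟨h2 m, fun hm => hm ▸ h1⟩
    simp [this]
  · intro v m
    simp

theorem IsCLPG.isCLAG {L : Set (PGLine F)} {x : ℕ} (h : IsCLPG L x) (hL : ∀ ℓ ∈ L, affLine ℓ) :
    IsCLAG L x := by
  refine ⟨hL, fun S hS => ?_⟩
  obtain ⟨b, hb0, hbsmul, hb⟩ := h.exists_weight
  have hbinf (v : Fin 4 → F) (hv : v ∈ infPlane F) : b v = 0 := by
    refine weight_eq_zero hb0 hbsmul finrank_infPlane (fun ℓ hℓ => ?_) hv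
    rw [hb, chi, if_neg fun hmem => hL ℓ hmem hℓ]
  obtain ⟨ℓ, -⟩ := hS.existsUnique (v := Pi.single 3 1) (by simp [infPlane])
  obtain ⟨T, hT, -⟩ := exists_isPGSpread_mem ℓ
  have h1 := sum_spread hb (S := S) fun v hv => hS.existsUnique fun hv' => hv (hbinf v hv')
  have h2 := sum_spread hb (S := T) fun v hv =>
    (isPGSpread_iff T).mp hT v fun hv' => hv (hv' ▸ hb0)
  rw [h T hT, ← h1] at h2
  exact_mod_cast h2.symm

end CL

/-- Let L be a Cameron-Liebler line class of parameter x in PG(3,q). Then the set of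
affine lines of L is a Cameron-Liebler line class of parameter x in AG(3,q) if and only
if L contains no line of the plane at infinity. -/
theorem projective_CL_restricts_iff (F : Type) [Field F] [Fintype F]
    (L : Set (CL.PGLine F)) (x : ℕ) (h : CL.IsCLPG L x) :
    CL.IsCLAG {ℓ ∈ L | CL.affLine ℓ} x ↔ ∀ ℓ ∈ L, CL.affLine ℓ := by
  constructor
  · intro hA ℓ hℓ
    by_contra hinf
    obtain ⟨S, hS, hℓS⟩ := CL.exists_isPGSpread_mem ℓ
    have hlt := Set.ncard_lt_ncard (s := {ℓ ∈ L | CL.affLine ℓ} ∩ {ℓ ∈ S | CL.affLine ℓ})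
      (t := L ∩ S) ⟨fun m hm => ⟨hm.1.1, hm.2.1⟩, fun hsub => hinf (hsub ⟨hℓ, hℓS⟩).1.2⟩
      (Set.toFinite _)
    rw [hA.2 _ hS.isAGSpread_s8, h S hS] at hlt
    exact lt_irrefl _ hlt
  · intro hL
    rw [Set.sep_eq_self_iff_mem_true.mpr hL]
    exact h.isCLAG hL
end
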